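/- arXiv:2505.19531 — 3 statements merged into one kernel-verified Lean document; each statement's English description precedes it below -/
import Mathlib

section
/- Fix ε > 0. There exist constants C > 0, c > 0, ρ ∈ (0,1], and d₀ such that the following holds for every integer d ≥ d₀, every even integer k with ρ·d ≤ k ≤ d, t := k/2, every integer n with n ≥ d^ε, and every target subset b = {j₁, …, j_k} ⊆ [d] of size k. Let x¹, …, xⁿ be i.i.d. uniform on {0,1}^d, write x_j ∈ ℝⁿ for the vector whose i-th entry is the j-th coordinate of xⁱ, and define teacher-forcing targets x_{d+i} ∈ ℝⁿ for i ∈ [t] by (x_{d+i})_l = (x_{j_{2i−1}})_l · (x_{j_{2i}})_l. Set X = (x₁ ⋯ x_d) ∈ ℝ^{n×d}, E = (x_{d+1} ⋯ x_{d+t}) ∈ ℝ^{n×t}, and define the surrogate loss L(W) = (1/(2n))·‖X·softmax(W) − E‖_F² for W ∈ ℝ^{d×t}. Initialize W⁽⁰⁾ = 0_{d×t} and take one gradient step W⁽¹⁾ = W⁽⁰⁾ − η·∇L(W⁽⁰⁾) with any learning rate η satisfying (1/C)·d^{1+ε/8} ≤ η ≤ C·d^{1+ε/8}. Then with probability at least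 1 − exp(−c·d^{ε/2}) over the samples, ‖2·softmax(W⁽¹⁾)·𝟏_t − v_b‖_∞ ≤ C·d^{−ε/8}. -/
/-- Column-wise softmax of W ∈ ℝ^{d×t}: softmax(W)_{(j,m)} = e^{W_{jm}} / Σ_i e^{W_{im}}. -/
noncomputable def colSoftmax {d t : ℕ} (W : Fin d → Fin t → ℝ) : Fin d → Fin t → ℝ :=
  fun j m => Real.exp (W j m) / ∑ i, Real.exp (W i m)

/-- Surrogate loss L(W) = (1/(2n))·‖X·softmax(W) − E‖_F². -/
noncomputable def attnLoss {n d t : ℕ} (X : Fin n → Fin d → ℝ) (E : Fin n → Fin t → ℝ)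
    (W : Fin d → Fin t → ℝ) : ℝ :=
  (1 / (2 * (n : ℝ))) * ∑ i, ∑ m, ((∑ j, X i j * colSoftmax W j m) - E i m) ^ 2

/-- One gradient step from W⁽⁰⁾ = 0: W⁽¹⁾ = 0 − η·∇L(0), where
(∇L(0))_{jm} is the partial derivative of L at 0 in the (j,m) coordinate. -/
noncomputable def oneStepGD {n d t : ℕ} (X : Fin n → Fin d → ℝ) (E : Fin n → Fin t → ℝ)
    (η : ℝ) : Fin d → Fin t → ℝ :=
  fun j m =>
    0 - η * fderiv ℝ (attnLoss X E) 0
      (fun j' m' => if j' = j ∧ m' = m then (1 : ℝ) else 0)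

theorem hasDerivAt_colSoftmax_line_zero {d t : ℕ} (hd : 0 < d) (v : Fin d → Fin t → ℝ)
    (j : Fin d) (m : Fin t) :
    HasDerivAt (fun s : ℝ => colSoftmax (s • v) j m)
      ((v j m - (∑ i, v i m) / d) / d) 0 := by
  have hd' : (d : ℝ) ≠ 0 := by positivity
  have h1 : ∀ i, HasDerivAt (fun s : ℝ => Real.exp (s * v i m)) (v i m) 0 := fun i => by
    simpa using ((hasDerivAt_id (0 : ℝ)).mul_const (v i m)).exp
  have h2 : HasDerivAt (fun s : ℝ => ∑ i, Real.exp (s * v i m)) (∑ i, v i m) 0 :=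
    HasDerivAt.fun_sum fun i _ => h1 i
  have h3 := (h1 j).fun_div h2 (by simpa using hd')
  simp only [colSoftmax, Pi.smul_apply, smul_eq_mul]
  refine h3.congr_deriv ?_
  simp
  field_simp

theorem differentiable_attnLoss {n d t : ℕ} (hd : 0 < d) (X : Fin n → Fin d → ℝ)
    (E : Fin n → Fin t → ℝ) : Differentiable ℝ (attnLoss X E) := by
  have : Nonempty (Fin d) := ⟨⟨0, hd⟩⟩
  have hne : ∀ (W : Fin d → Fin t → ℝ) (m : Fin t), ∑ i, Real.exp (W i m) ≠ 0 := fun W m =>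
    (Finset.sum_pos (fun i _ => Real.exp_pos _) Finset.univ_nonempty).ne'
  have hs : ∀ j m, Differentiable ℝ fun W : Fin d → Fin t → ℝ => colSoftmax W j m := fun j m => by
    simp only [colSoftmax, div_eq_mul_inv]
    exact Differentiable.fun_mul (by fun_prop)
      (Differentiable.fun_inv (by fun_prop) fun W => hne W m)
  unfold attnLoss
  fun_prop

theorem fderiv_attnLoss_zero {n d t : ℕ} (hd : 0 < d) (X : Fin n → Fin d → ℝ)
    (E : Fin n → Fin t → ℝ) (v : Fin d → Fin t → ℝ) :
    fderiv ℝ (attnLoss X E) 0 v =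
      (1 / (n : ℝ)) * ∑ i, ∑ m, ((∑ j, X i j) / d - E i m) *
        ∑ j, X i j * ((v j m - (∑ l, v l m) / d) / d) := by
  rw [← (differentiable_attnLoss hd X E 0).lineDeriv_eq_fderiv, lineDeriv]
  simp only [zero_add, attnLoss]
  have h : ∀ i m, HasDerivAt
      (fun s : ℝ => ((∑ j, X i j * colSoftmax (s • v) j m) - E i m) ^ 2)
      (2 * (((∑ j, X i j) / d - E i m) *
        ∑ j, X i j * ((v j m - (∑ l, v l m) / d) / d))) 0 := fun i m => by
    have h0 := ((HasDerivAt.fun_sum fun j (_ : j ∈ Finset.univ) =>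
      (hasDerivAt_colSoftmax_line_zero hd v j m).const_mul (X i j)).sub_const (E i m)).fun_pow 2
    refine h0.congr_deriv ?_
    simp [colSoftmax, div_eq_mul_inv, ← Finset.sum_mul]
    ring
  have h' := (HasDerivAt.fun_sum fun i (_ : i ∈ Finset.univ) =>
    HasDerivAt.fun_sum fun m (_ : m ∈ Finset.univ) => h i m).const_mul (1 / (2 * (n : ℝ)))
  rw [h'.deriv]
  simp only [← Finset.mul_sum]
  rw [← mul_assoc]
  congr 1
  field_simp

theorem oneStepGD_apply {n d t : ℕ} (hd : 0 < d) (X : Fin n → Fin d → ℝ)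
    (E : Fin n → Fin t → ℝ) (η : ℝ) (j : Fin d) (m : Fin t) :
    oneStepGD X E η j m =
      η / d * ((1 / (n : ℝ)) * ∑ i, (E i m - (∑ l, X i l) / d) * (X i j - (∑ l, X i l) / d)) := by
  rw [oneStepGD, fderiv_attnLoss_zero hd]
  have key : ∀ i, ∑ m', ((∑ l, X i l) / d - E i m') *
      ∑ l, X i l * (((if l = j ∧ m' = m then (1 : ℝ) else 0) -
        (∑ l', if l' = j ∧ m' = m then (1 : ℝ) else 0) / d) / d) =
      -(1 / d * ((E i m - (∑ l, X i l) / d) * (X i j - (∑ l, X i l) / d))) := fun i => by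
    rw [Finset.sum_eq_single m]
    · have h : ∑ l, X i l * (((if l = j then (1 : ℝ) else 0) - 1 / d) / d) =
          (X i j - (∑ l, X i l) / d) / d := by
        simp only [← mul_div_assoc, ← Finset.sum_div, mul_sub, Finset.sum_sub_distrib]
        simp
      simp only [and_true, Finset.sum_ite_eq', Finset.mem_univ, if_true, h]
      ring
    · intro m' _ hm
      simp [hm]
    · simp
  simp only [key]
  rw [Finset.sum_neg_distrib, ← Finset.mul_sum]
  ring

theorem oneStepGD_sub_oneStepGD {n d t : ℕ} (hd : 0 < d) (X : Fin n → Fin d → ℝ)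
    (E : Fin n → Fin t → ℝ) (η : ℝ) (a j : Fin d) (m : Fin t) :
    oneStepGD X E η a m - oneStepGD X E η j m =
      η / d * ((1 / (n : ℝ)) * ∑ i, (E i m - (∑ l, X i l) / d) * (X i a - X i j)) := by
  rw [oneStepGD_apply hd, oneStepGD_apply hd, ← mul_sub, ← mul_sub, ← Finset.sum_sub_distrib]
  congr 2
  exact Finset.sum_congr rfl fun i _ => by ring

theorem colSoftmax_nonneg {d t : ℕ} (W : Fin d → Fin t → ℝ) (j : Fin d) (m : Fin t) :
    0 ≤ colSoftmax W j m := by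
  unfold colSoftmax; positivity

theorem colSoftmax_le_exp_sub {d t : ℕ} (W : Fin d → Fin t → ℝ) (a j : Fin d) (m : Fin t) :
    colSoftmax W j m ≤ Real.exp (W j m - W a m) := by
  rw [colSoftmax, Real.exp_sub]
  gcongr
  exact Finset.single_le_sum (f := fun i => Real.exp (W i m)) (fun i _ => (Real.exp_pos _).le)
    (Finset.mem_univ a)

/-- If two entries of a column are `δ`-close and every other entry lies below the first one by at
least `M`, the softmax splits almost evenly between the two. -/
theorem abs_two_mul_colSoftmax_sub_indicator_le {d t : ℕ} (W : Fin d → Fin t → ℝ) (m : Fin t)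
    {a b : Fin d} (hab : a ≠ b) {δ M : ℝ} (hδ : δ ≤ 1) (hclose : |W a m - W b m| ≤ δ)
    (hfar : ∀ j, j ≠ a → j ≠ b → M ≤ W a m - W j m) {j : Fin d} (hj : j = a ∨ j = b) :
    |2 * colSoftmax W j m - 1| ≤ 2 * δ + d * Real.exp (-M) := by
  set r : ℝ := ∑ i ∈ (Finset.univ.erase a).erase b, Real.exp (W i m - W a m) with hr
  set q : ℝ := Real.exp (W b m - W a m) with hq
  have hq0 : 0 < q := Real.exp_pos _
  have hr0 : 0 ≤ r := Finset.sum_nonneg fun i _ => (Real.exp_pos _).le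
  have hrle : r ≤ d * Real.exp (-M) := by
    calc r ≤ ∑ i ∈ (Finset.univ.erase a).erase b, Real.exp (-M) := by
          refine Finset.sum_le_sum fun i hi => Real.exp_le_exp.2 ?_
          simp only [Finset.mem_erase, Finset.mem_univ, and_true] at hi
          linarith [hfar i hi.2 hi.1]
      _ ≤ ∑ _i : Fin d, Real.exp (-M) :=
          Finset.sum_le_sum_of_subset_of_nonneg (Finset.subset_univ _)
            fun _ _ _ => (Real.exp_pos _).le
      _ = d * Real.exp (-M) := by simp
  have hq1 : |q - 1| ≤ 2 * δ := by
    have h : |W b m - W a m| ≤ δ := by rwa [abs_sub_comm]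
    exact (Real.abs_exp_sub_one_le (h.trans hδ)).trans (by linarith)
  have hsum : ∑ i, Real.exp (W i m) = Real.exp (W a m) * (1 + q + r) := by
    have : ∑ i, Real.exp (W i m - W a m) = 1 + q + r := by
      rw [← Finset.add_sum_erase _ _ (Finset.mem_univ a),
        ← Finset.add_sum_erase _ _ (Finset.mem_erase.2 ⟨hab.symm, Finset.mem_univ b⟩)]
      simp [hq, hr, add_assoc]
    rw [← this, Finset.mul_sum]
    exact Finset.sum_congr rfl fun i _ => by rw [← Real.exp_add]; congr 1; ring
  have hD : 1 ≤ 1 + q + r := by linarith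
  have hquot : ∀ y : ℝ, |y| ≤ 2 * δ + d * Real.exp (-M) →
      |y / (1 + q + r)| ≤ 2 * δ + d * Real.exp (-M) := fun y hy => by
    rw [abs_div, abs_of_pos (by linarith : (0 : ℝ) < 1 + q + r)]
    exact (div_le_self (abs_nonneg y) hD).trans hy
  have hne : 1 + q + r ≠ 0 := by linarith
  obtain ⟨hq2, hq3⟩ := abs_le.1 hq1
  rcases hj with rfl | rfl
  · have : 2 * colSoftmax W j m - 1 = (1 - q - r) / (1 + q + r) := by
      rw [colSoftmax, hsum]
      field_simp
      ring
    rw [this]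
    exact hquot _ (abs_le.2 ⟨by linarith, by linarith⟩)
  · have : 2 * colSoftmax W j m - 1 = (q - 1 - r) / (1 + q + r) := by
      have h : Real.exp (W j m) = Real.exp (W a m) * q := by
        rw [hq, ← Real.exp_add]; congr 1; ring
      rw [colSoftmax, hsum, h]
      field_simp
      ring
    rw [this]
    exact hquot _ (abs_le.2 ⟨by linarith, by linarith⟩)

theorem exp_le_exp_sq_add {x : ℝ} (hx : |x| ≤ 1) : Real.exp x ≤ 1 + x + x ^ 2 := by
  have := (abs_le.1 (Real.abs_exp_sub_one_sub_id_le hx)).2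
  linarith

/-- A Chernoff bound by counting: the tail of a sum of independent copies of a centred function
bounded by `2` on a finite uniform space. -/
theorem card_filter_le_sum_le {α : Type*} [Fintype α] (g : α → ℝ) (hg : ∀ y, |g y| ≤ 2)
    (hg0 : ∑ y, g y = 0) (n : ℕ) {τ : ℝ} (hτ0 : 0 ≤ τ) (hτ : τ ≤ 4) :
    ((Finset.univ.filter fun x : Fin n → α => n * τ ≤ ∑ i, g (x i)).card : ℝ) ≤
      Real.exp (-(n * τ ^ 2 / 16)) * (Fintype.card α : ℝ) ^ n := by
  classical
  have hmgf : ∑ y, Real.exp (τ / 8 * g y) ≤ Fintype.card α * Real.exp (τ ^ 2 / 16) := by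
    have hpt : ∀ y, Real.exp (τ / 8 * g y) ≤ 1 + τ / 8 * g y + τ ^ 2 / 16 := fun y => by
      have h1 : |τ / 8 * g y| ≤ 1 := by
        rw [abs_mul, abs_of_nonneg (by positivity : 0 ≤ τ / 8)]
        nlinarith [hg y, abs_nonneg (g y)]
      have h2 : g y ^ 2 ≤ 4 := by
        have := sq_le_sq' (abs_le.1 (hg y)).1 (abs_le.1 (hg y)).2
        linarith
      nlinarith [exp_le_exp_sq_add h1, sq_nonneg τ]
    calc ∑ y, Real.exp (τ / 8 * g y) ≤ ∑ y, (1 + τ / 8 * g y + τ ^ 2 / 16) :=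
          Finset.sum_le_sum fun y _ => hpt y
      _ = Fintype.card α * (τ ^ 2 / 16 + 1) := by
          simp only [Finset.sum_add_distrib, ← Finset.mul_sum, hg0]
          simp
          ring
      _ ≤ _ := by gcongr; exact Real.add_one_le_exp _
  have hprod : ∑ x : Fin n → α, Real.exp (τ / 8 * ∑ i, g (x i)) =
      (∑ y, Real.exp (τ / 8 * g y)) ^ n := by
    rw [Finset.sum_pow', Fintype.piFinset_univ]
    exact Finset.sum_congr rfl fun x _ => by rw [Finset.mul_sum, Real.exp_sum]
  have hmarkov : ((Finset.univ.filter fun x : Fin n → α => n * τ ≤ ∑ i, g (x i)).card : ℝ) *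
      Real.exp (n * τ ^ 2 / 8) ≤ (∑ y, Real.exp (τ / 8 * g y)) ^ n := by
    rw [← hprod, ← nsmul_eq_mul]
    refine (Finset.card_nsmul_le_sum _ (fun x : Fin n → α => Real.exp (τ / 8 * ∑ i, g (x i))) _
      fun x hx => ?_).trans (Finset.sum_le_sum_of_subset_of_nonneg (Finset.subset_univ _)
        fun _ _ _ => (Real.exp_pos _).le)
    have := (Finset.mem_filter.1 hx).2
    exact Real.exp_le_exp.2 (by nlinarith)
  have hpow : (∑ y, Real.exp (τ / 8 * g y)) ^ n ≤
      (Fintype.card α : ℝ) ^ n * Real.exp (n * τ ^ 2 / 16) := by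
    calc _ ≤ (Fintype.card α * Real.exp (τ ^ 2 / 16)) ^ n := by gcongr
      _ = _ := by rw [mul_pow, ← Real.exp_nat_mul]; congr 2; ring
  rw [← mul_le_mul_iff_left₀ (Real.exp_pos (n * τ ^ 2 / 8))]
  refine (hmarkov.trans hpow).trans_eq ?_
  rw [mul_right_comm, ← Real.exp_add, mul_comm]
  congr 2
  ring

theorem sum_mul_ite_of_flip_invariant {ι : Type*} [Fintype ι] [DecidableEq ι] (j : ι)
    (h : (ι → Bool) → ℝ) (hh : ∀ y, h (Function.update y j (!y j)) = h y) :
    ∑ y, h y * (if y j then (1 : ℝ) else 0) = (∑ y, h y) / 2 := by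
  have hinv : Function.Involutive fun y : ι → Bool => Function.update y j (!y j) := fun y => by
    simp
  have h1 := Equiv.sum_comp (hinv.toPerm _) fun y => h y * (if y j then (1 : ℝ) else 0)
  have h2 : ∑ y, h y * (if y j then (1 : ℝ) else 0) +
      ∑ y, h ((hinv.toPerm _) y) * (if (hinv.toPerm _) y j then (1 : ℝ) else 0) = ∑ y, h y := by
    rw [← Finset.sum_add_distrib]
    refine Finset.sum_congr rfl fun y _ => ?_
    simp only [Function.Involutive.coe_toPerm, hh, Function.update_self]
    cases y j <;> simp
  linarith

theorem sum_mul_ite_sub_ite_of_swap_invariant {ι : Type*} [Fintype ι] [DecidableEq ι] (a j : ι)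
    (h : (ι → Bool) → ℝ) (hh : ∀ y, h (y ∘ Equiv.swap a j) = h y) :
    ∑ y, h y * ((if y a then (1 : ℝ) else 0) - (if y j then (1 : ℝ) else 0)) = 0 := by
  have h1 := Equiv.sum_comp ((Equiv.swap a j).arrowCongr (Equiv.refl Bool))
    fun y => h y * ((if y a then (1 : ℝ) else 0) - (if y j then (1 : ℝ) else 0))
  have h2 : ∀ y, ((Equiv.swap a j).arrowCongr (Equiv.refl Bool)) y = y ∘ Equiv.swap a j :=
    fun y => by ext; simp
  simp only [h2, hh, Function.comp_apply, Equiv.swap_apply_left, Equiv.swap_apply_right] at h1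
  have h3 : ∑ y, h y * ((if y a then (1 : ℝ) else 0) - (if y j then (1 : ℝ) else 0)) =
      -∑ y, h y * ((if y j then (1 : ℝ) else 0) - (if y a then (1 : ℝ) else 0)) := by
    rw [← Finset.sum_neg_distrib]
    exact Finset.sum_congr rfl fun y _ => by ring
  linarith

/-- The contribution of one sample `y` to the difference between the gradient step in the
coordinates `a` and `j`, in the column whose target is the conjunction of the bits `a` and `b`. -/
noncomputable def sampleGap {d : ℕ} (a b j : Fin d) (y : Fin d → Bool) : ℝ :=
  ((if y a then (1 : ℝ) else 0) * (if y b then (1 : ℝ) else 0) -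
      (∑ l, if y l then (1 : ℝ) else 0) / d) *
    ((if y a then (1 : ℝ) else 0) - (if y j then (1 : ℝ) else 0))

theorem abs_sampleGap_le_one {d : ℕ} (a b j : Fin d) (y : Fin d → Bool) :
    |sampleGap a b j y| ≤ 1 := by
  have hd : (0 : ℝ) < d := by exact_mod_cast a.pos
  have h0 : 0 ≤ (∑ l, if y l then (1 : ℝ) else 0) / d := by positivity
  have h1 : (∑ l, if y l then (1 : ℝ) else 0) / d ≤ 1 := by
    rw [div_le_one hd]
    calc (∑ l, if y l then (1 : ℝ) else 0) ≤ ∑ _l : Fin d, (1 : ℝ) :=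
          Finset.sum_le_sum fun l _ => by split_ifs <;> norm_num
      _ = d := by simp
  rw [sampleGap, abs_mul]
  refine mul_le_one₀ ?_ (abs_nonneg _) ?_
  · rw [abs_le]
    split_ifs <;> constructor <;> linarith
  · split_ifs <;> norm_num

theorem sum_bitMean_mul_sub {d : ℕ} (a j : Fin d) :
    ∑ y : Fin d → Bool, (∑ l, if y l then (1 : ℝ) else 0) / d *
      ((if y a then (1 : ℝ) else 0) - (if y j then (1 : ℝ) else 0)) = 0 := by
  refine sum_mul_ite_sub_ite_of_swap_invariant a j _ fun y => ?_
  congr 1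
  exact Equiv.sum_comp (Equiv.swap a j) fun l => if y l then (1 : ℝ) else 0

theorem sum_sampleGap_self_right {d : ℕ} (a b : Fin d) : ∑ y, sampleGap a b b y = 0 := by
  simp only [sampleGap, sub_mul, Finset.sum_sub_distrib]
  rw [sum_bitMean_mul_sub, sub_zero]
  refine sum_mul_ite_sub_ite_of_swap_invariant a b
    (fun y => (if y a then (1 : ℝ) else 0) * (if y b then (1 : ℝ) else 0)) fun y => ?_
  simp [mul_comm]

theorem sum_sampleGap_of_ne {d : ℕ} {a b j : Fin d} (hab : a ≠ b) (hja : j ≠ a) (hjb : j ≠ b) :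
    ∑ y, sampleGap a b j y = Fintype.card (Fin d → Bool) / 8 := by
  simp only [sampleGap, sub_mul, Finset.sum_sub_distrib]
  rw [sum_bitMean_mul_sub, sub_zero]
  have h1 := sum_mul_ite_of_flip_invariant a (fun _ => (1 : ℝ)) fun _ => rfl
  have h2 := sum_mul_ite_of_flip_invariant b (fun y => if y a then (1 : ℝ) else 0)
    fun y => by rw [Function.update_of_ne hab]
  have h3 := sum_mul_ite_of_flip_invariant j
    (fun y => (if y a then (1 : ℝ) else 0) * (if y b then (1 : ℝ) else 0))
    fun y => by rw [Function.update_of_ne hja.symm, Function.update_of_ne hjb.symm]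
  simp only [one_mul] at h1
  simp only [Finset.sum_const, Finset.card_univ, nsmul_eq_mul, mul_one] at h1
  have h4 : ∀ y : Fin d → Bool, (if y a then (1 : ℝ) else 0) * (if y b then (1 : ℝ) else 0) *
      ((if y a then (1 : ℝ) else 0) - (if y j then (1 : ℝ) else 0)) =
      (if y a then (1 : ℝ) else 0) * (if y b then (1 : ℝ) else 0) -
      (if y a then (1 : ℝ) else 0) * (if y b then (1 : ℝ) else 0) *
        (if y j then (1 : ℝ) else 0) := fun y => by
    cases y a <;> cases y b <;> simp
  simp only [h4, Finset.sum_sub_distrib]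
  rw [h3, h2, h1]
  ring

/-- A union bound over finitely many Chernoff events. -/
theorem card_filter_exists_le_sum_le {κ α : Type*} [Fintype κ] [Fintype α] (g : κ → α → ℝ)
    (hg : ∀ k y, |g k y| ≤ 2) (hg0 : ∀ k, ∑ y, g k y = 0) (n : ℕ) {τ : ℝ} (hτ0 : 0 ≤ τ)
    (hτ : τ ≤ 4) [DecidablePred fun x : Fin n → α => ∃ k, n * τ ≤ ∑ i, g k (x i)] :
    ((Finset.univ.filter fun x : Fin n → α => ∃ k, n * τ ≤ ∑ i, g k (x i)).card : ℝ) ≤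
      Fintype.card κ * (Real.exp (-(n * τ ^ 2 / 16)) * (Fintype.card α : ℝ) ^ n) := by
  classical
  have hsub : (Finset.univ.filter fun x : Fin n → α => ∃ k, n * τ ≤ ∑ i, g k (x i)) ⊆
      Finset.univ.biUnion fun k =>
        Finset.univ.filter fun x : Fin n → α => n * τ ≤ ∑ i, g k (x i) := fun x hx => by
    simpa using hx
  have h1 : ((Finset.univ.filter fun x : Fin n → α => ∃ k, n * τ ≤ ∑ i, g k (x i)).card : ℝ) ≤
      ∑ k, ((Finset.univ.filter fun x : Fin n → α => n * τ ≤ ∑ i, g k (x i)).card : ℝ) := by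
    exact_mod_cast (Finset.card_le_card hsub).trans Finset.card_biUnion_le
  refine (h1.trans (Finset.sum_le_sum fun k _ =>
    card_filter_le_sum_le (g k) (hg k) (hg0 k) n hτ0 hτ)).trans_eq ?_
  simp

/-- The expected value of `sampleGap a b j`. -/
noncomputable def meanGap {d : ℕ} (a b j : Fin d) : ℝ := if j = a ∨ j = b then 0 else 1 / 8

theorem sum_sampleGap_sub_meanGap {d : ℕ} {a b : Fin d} (hab : a ≠ b) (j : Fin d) :
    ∑ y, (sampleGap a b j y - meanGap a b j) = 0 := by
  rw [Finset.sum_sub_distrib, Finset.sum_const, Finset.card_univ, nsmul_eq_mul, meanGap]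
  by_cases hja : j = a
  · simp [hja, sampleGap]
  by_cases hjb : j = b
  · simp [hjb, sum_sampleGap_self_right]
  rw [sum_sampleGap_of_ne hab hja hjb]
  simp [hja, hjb]
  ring

theorem abs_sampleGap_sub_meanGap_le {d : ℕ} (a b j : Fin d) (y : Fin d → Bool) :
    |sampleGap a b j y - meanGap a b j| ≤ 2 := by
  have h := abs_le.1 (abs_sampleGap_le_one a b j y)
  rw [meanGap, abs_le]
  split_ifs <;> constructor <;> linarith

/-- Except for few sample sets, all empirical gaps are close to their means. -/
theorem card_filter_exists_gap_deviation_le {d t n : ℕ} (a b : Fin t → Fin d)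
    (hab : ∀ m, a m ≠ b m) {τ : ℝ} (hτ0 : 0 ≤ τ) (hτ : τ ≤ 4)
    [DecidablePred fun x : Fin n → Fin d → Bool => ∃ m j,
      n * τ ≤ |∑ i, (sampleGap (a m) (b m) j (x i) - meanGap (a m) (b m) j)|] :
    ((Finset.univ.filter fun x : Fin n → Fin d → Bool => ∃ m j,
      n * τ ≤ |∑ i, (sampleGap (a m) (b m) j (x i) - meanGap (a m) (b m) j)|).card : ℝ) ≤
      2 * t * d * (Real.exp (-(n * τ ^ 2 / 16)) * Fintype.card (Fin n → Fin d → Bool)) := by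
  classical
  let g : Fin t × Fin d × Bool → (Fin d → Bool) → ℝ := fun k y =>
    (if k.2.2 then 1 else -1) *
      (sampleGap (a k.1) (b k.1) k.2.1 y - meanGap (a k.1) (b k.1) k.2.1)
  have h := card_filter_exists_le_sum_le g (fun k y => by
      have := abs_sampleGap_sub_meanGap_le (a k.1) (b k.1) k.2.1 y
      simp only [g, abs_mul]
      split_ifs <;> simpa using this)
    (fun k => by simp only [g, ← Finset.mul_sum, sum_sampleGap_sub_meanGap (hab k.1), mul_zero])
    n hτ0 hτ
  have hcard : (Fintype.card (Fin n → Fin d → Bool) : ℝ) =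
      (Fintype.card (Fin d → Bool) : ℝ) ^ n := by
    rw [Fintype.card_fun, Fintype.card_fin, Nat.cast_pow]
  have hκ : (Fintype.card (Fin t × Fin d × Bool) : ℝ) = 2 * t * d := by
    simp
    ring
  rw [hκ] at h
  rw [hcard]
  refine le_trans ?_ h
  refine Nat.cast_le.2 (Finset.card_le_card fun x hx => ?_)
  obtain ⟨m, j, hmj⟩ := (Finset.mem_filter.1 hx).2
  refine Finset.mem_filter.2 ⟨Finset.mem_univ _, ?_⟩
  rcases le_abs.1 hmj with h' | h'
  · exact ⟨(m, j, true), by simpa [g] using h'⟩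
  · refine ⟨(m, j, false), ?_⟩
    simp only [g, ← Finset.mul_sum]
    simpa using h'

theorem two_mul_val_lt {t : ℕ} (m : Fin t) : 2 * (m : ℕ) < 2 * t := by omega

theorem two_mul_val_add_one_lt {t : ℕ} (m : Fin t) : 2 * (m : ℕ) + 1 < 2 * t := by omega

theorem sum_pair_indicator {d t : ℕ} (jb : Fin (2 * t) → Fin d) (hjb : Function.Injective jb)
    (j : Fin d) :
    ∑ m : Fin t, (if j = jb ⟨2 * (m : ℕ), two_mul_val_lt m⟩ ∨
          j = jb ⟨2 * (m : ℕ) + 1, two_mul_val_add_one_lt m⟩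
      then (1 : ℝ) else 0) = if ∃ i, jb i = j then 1 else 0 := by
  by_cases h : ∃ i, jb i = j
  · obtain ⟨i, rfl⟩ := h
    have hi := i.isLt
    rw [Finset.sum_eq_single ⟨(i : ℕ) / 2, by omega⟩, if_pos, if_pos ⟨i, rfl⟩]
    · rcases Nat.even_or_odd' (i : ℕ) with ⟨r, hr | hr⟩
      · exact Or.inl (congrArg jb (Fin.ext (by simp only; omega)))
      · exact Or.inr (congrArg jb (Fin.ext (by simp only; omega)))
    · intro m _ hm
      refine if_neg ?_
      rintro (h | h) <;>
      · have := congrArg Fin.val (hjb h)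
        exact hm (Fin.ext (by simp only at this ⊢; omega))
    · simp
  · rw [if_neg h]
    refine Finset.sum_eq_zero fun m _ => if_neg ?_
    rintro (h' | h') <;> exact h ⟨_, h'.symm⟩

/-- If in every column of `W` the two entries indexed by the pair dominate, twice the row sums of
the softmax are close to the indicator of the union of the pairs. -/
theorem abs_two_mul_sum_colSoftmax_sub_le {d t : ℕ} (htd : 2 * t ≤ d) (W : Fin d → Fin t → ℝ)
    (jb : Fin (2 * t) → Fin d) (hjb : Function.Injective jb) {δ M : ℝ} (hδ0 : 0 ≤ δ) (hδ : δ ≤ 1)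
    (hclose : ∀ m : Fin t, |W (jb ⟨2 * (m : ℕ), two_mul_val_lt m⟩) m -
      W (jb ⟨2 * (m : ℕ) + 1, two_mul_val_add_one_lt m⟩) m| ≤ δ)
    (hfar : ∀ (m : Fin t) (j : Fin d), j ≠ jb ⟨2 * (m : ℕ), two_mul_val_lt m⟩ →
      j ≠ jb ⟨2 * (m : ℕ) + 1, two_mul_val_add_one_lt m⟩ →
      M ≤ W (jb ⟨2 * (m : ℕ), two_mul_val_lt m⟩) m - W j m)
    (j : Fin d) :
    |2 * (∑ m, colSoftmax W j m) - (if ∃ i, jb i = j then (1 : ℝ) else 0)| ≤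
      2 * δ + 2 * (d * Real.exp (-M)) := by
  have htd' : (2 : ℝ) * t ≤ d := by exact_mod_cast htd
  have hterm : ∀ m : Fin t, |2 * colSoftmax W j m -
      (if j = jb ⟨2 * (m : ℕ), two_mul_val_lt m⟩ ∨
          j = jb ⟨2 * (m : ℕ) + 1, two_mul_val_add_one_lt m⟩
        then (1 : ℝ) else 0)| ≤
      (if j = jb ⟨2 * (m : ℕ), two_mul_val_lt m⟩ ∨
          j = jb ⟨2 * (m : ℕ) + 1, two_mul_val_add_one_lt m⟩
        then (1 : ℝ) else 0) * (2 * δ + d * Real.exp (-M)) + 2 * Real.exp (-M) := fun m => by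
    split_ifs with h
    · have hne : jb ⟨2 * (m : ℕ), two_mul_val_lt m⟩ ≠
          jb ⟨2 * (m : ℕ) + 1, two_mul_val_add_one_lt m⟩ := fun h => by
        have := congrArg Fin.val (hjb h)
        simp only at this
        omega
      have := abs_two_mul_colSoftmax_sub_indicator_le W m hne hδ (hclose m) (hfar m) h
      have := Real.exp_pos (-M)
      linarith
    · rw [not_or] at h
      have h1 := colSoftmax_le_exp_sub W (jb ⟨2 * (m : ℕ), two_mul_val_lt m⟩) j m
      have h2 : Real.exp (W j m - W (jb ⟨2 * (m : ℕ), two_mul_val_lt m⟩) m) ≤ Real.exp (-M) :=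
        Real.exp_le_exp.2 (by linarith [hfar m j h.1 h.2])
      have h3 := colSoftmax_nonneg W j m
      rw [sub_zero, abs_of_nonneg (by linarith)]
      linarith
  rw [← sum_pair_indicator jb hjb j, Finset.mul_sum, ← Finset.sum_sub_distrib]
  refine (Finset.abs_sum_le_sum_abs _ _).trans ((Finset.sum_le_sum fun m _ => hterm m).trans ?_)
  rw [Finset.sum_add_distrib, ← Finset.sum_mul, sum_pair_indicator jb hjb j]
  have he := Real.exp_pos (-M)
  have h1 : 2 * (t : ℝ) * Real.exp (-M) ≤ d * Real.exp (-M) := by gcongr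
  simp only [Finset.sum_const, Finset.card_univ, Fintype.card_fin, nsmul_eq_mul]
  have h2 : 0 ≤ (d : ℝ) * Real.exp (-M) := by positivity
  split_ifs <;> linarith

theorem eventually_rpow_mul_exp_neg_le_one (s : ℝ) {p β : ℝ} (hp : 0 < p) (hβ : 0 < β) :
    ∀ᶠ d : ℕ in Filter.atTop, (d : ℝ) ^ s * Real.exp (-(β * (d : ℝ) ^ p)) ≤ 1 := by
  have h := (tendsto_rpow_mul_exp_neg_mul_atTop_nhds_zero (s / p) β hβ).comp
    ((tendsto_rpow_atTop hp).comp tendsto_natCast_atTop_atTop)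
  filter_upwards [h.eventually (eventually_le_nhds zero_lt_one)] with d hd
  have hpow : ((d : ℝ) ^ p) ^ (s / p) = (d : ℝ) ^ s := by
    rw [← Real.rpow_mul (Nat.cast_nonneg d), mul_div_cancel₀ _ hp.ne']
  simpa [hpow] using hd

/-- upper bound: one-step learnability of k-bit AND with teacher
forcing.  Fix ε > 0.  There are constants C, c > 0, ρ ∈ (0,1], d₀ such that
for every d ≥ d₀, every even k = 2t with ρd ≤ k ≤ d, every n ≥ d^ε, every
target subset b = {jb 0, …, jb (k−1)} of size k (given by an injection jb),
and every learning rate η with d^{1+ε/8}/C ≤ η ≤ C·d^{1+ε/8}: with probability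
at least 1 − e^{−c d^{ε/2}} over the i.i.d. uniform samples x ∈ ({0,1}^d)ⁿ
(X the sample matrix, E the teacher-forcing pairwise-product targets),
‖2·softmax(W⁽¹⁾)·𝟏_t − v_b‖_∞ ≤ C·d^{−ε/8}.  Probability over the uniform
finite sample space is expressed by counting. -/
theorem stmt_0 (ε : ℝ) (hε : 0 < ε) :
    ∃ (C c ρ : ℝ) (d₀ : ℕ), 0 < C ∧ 0 < c ∧ 0 < ρ ∧ ρ ≤ 1 ∧
      ∀ (d t n : ℕ), d₀ ≤ d → ρ * (d : ℝ) ≤ 2 * (t : ℝ) → 2 * t ≤ d →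
        (d : ℝ) ^ ε ≤ (n : ℝ) →
        ∀ jb : Fin (2 * t) → Fin d, Function.Injective jb →
        ∀ η : ℝ, (1 / C) * (d : ℝ) ^ (1 + ε / 8) ≤ η →
          η ≤ C * (d : ℝ) ^ (1 + ε / 8) →
          (1 - Real.exp (-(c * (d : ℝ) ^ (ε / 2)))) *
              (Fintype.card (Fin n → Fin d → Bool) : ℝ) ≤
            (Nat.card {x : Fin n → Fin d → Bool //
              ∀ j : Fin d,
                |2 * (∑ m : Fin t,
                    colSoftmax
                      (oneStepGD
                        (fun i j' => if x i j' then (1 : ℝ) else 0)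
                        (fun l m' =>
                          (if x l (jb ⟨2 * (m' : ℕ), by omega⟩) then (1 : ℝ) else 0) *
                          (if x l (jb ⟨2 * (m' : ℕ) + 1, by omega⟩) then (1 : ℝ) else 0))
                        η) j m) -
                  (if ∃ i, jb i = j then (1 : ℝ) else 0)| ≤
                C * (d : ℝ) ^ (-(ε / 8))} : ℝ) := by
  classical
  obtain ⟨d₀, hd₀⟩ := Filter.eventually_atTop.1 ((Filter.eventually_ge_atTop 2).and
    ((eventually_rpow_mul_exp_neg_le_one 3 (half_pos hε) (by norm_num : (0 : ℝ) < 1 / 8192)).and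
      (eventually_rpow_mul_exp_neg_le_one (2 + ε / 8) (p := ε / 8) (by positivity)
        (by norm_num : (0 : ℝ) < 1 / 32))))
  refine ⟨2, 1 / 8192, 1 / 2, d₀, by norm_num, by norm_num, by norm_num, by norm_num, ?_⟩
  intro d t n hd _ htd hn jb hjb η hη₁ hη₂
  obtain ⟨hd2, hprob, herr⟩ := hd₀ d hd
  have hdpos : 0 < d := by omega
  have hd2' : (2 : ℝ) ≤ d := by exact_mod_cast hd2
  have hdr : (0 : ℝ) < d := by linarith
  set P : ℝ := (d : ℝ) ^ (ε / 8) with hP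
  have hP1 : 1 ≤ P := Real.one_le_rpow (by linarith) (by positivity)
  have hP0 : 0 < P := by linarith
  have hPneg : (d : ℝ) ^ (-(ε / 8)) = P⁻¹ := Real.rpow_neg hdr.le _
  have hP4 : (d : ℝ) ^ (ε / 2) = P ^ 4 := by
    rw [hP, ← Real.rpow_natCast, ← Real.rpow_mul hdr.le]
    congr 1
    push_cast
    ring
  have hP8 : (d : ℝ) ^ ε = P ^ 8 := by
    rw [hP, ← Real.rpow_natCast, ← Real.rpow_mul hdr.le]
    congr 1
    push_cast
    ring
  have hPη : (d : ℝ) ^ (1 + ε / 8) = d * P := by rw [Real.rpow_add hdr, Real.rpow_one]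
  have hP3 : (d : ℝ) ^ (2 + ε / 8) = d ^ 2 * P := by
    rw [Real.rpow_add hdr]
    norm_cast
  have hd3 : (d : ℝ) ^ (3 : ℝ) = d ^ 3 := by norm_cast
  rw [hP4, hd3] at hprob
  rw [hP3] at herr
  rw [hPη] at hη₁ hη₂
  rw [hP8] at hn
  rw [hPneg, hP4]
  have hnpos : (0 : ℝ) < n := lt_of_lt_of_le (by positivity) hn
  have htd' : 2 * (t : ℝ) ≤ d := by exact_mod_cast htd
  set τ : ℝ := (P ^ 2)⁻¹ / 16 with hτ
  have hτ0 : 0 < τ := by positivity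
  have hτ1 : τ ≤ 1 / 16 := by
    have : (P ^ 2)⁻¹ ≤ 1 := inv_le_one_of_one_le₀ (one_le_pow₀ hP1)
    linarith
  have hηd₁ : P / 2 ≤ η / d := by
    rw [le_div_iff₀ hdr]
    linarith
  have hηd₂ : η / d ≤ 2 * P := by
    rw [div_le_iff₀ hdr]
    linarith
  set a : Fin t → Fin d := fun m => jb ⟨2 * (m : ℕ), by omega⟩ with ha
  set b : Fin t → Fin d := fun m => jb ⟨2 * (m : ℕ) + 1, by omega⟩ with hb
  have hab : ∀ m, a m ≠ b m := fun m h => by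
    have := congrArg Fin.val (hjb h)
    simp only at this
    omega
  have hbad := card_filter_exists_gap_deviation_le (n := n) a b hab hτ0.le (by linarith)
  set N : ℝ := (Fintype.card (Fin n → Fin d → Bool) : ℝ) with hN
  have hsmall : 2 * t * d * (Real.exp (-(n * τ ^ 2 / 16)) * N) ≤
      Real.exp (-(1 / 8192 * P ^ 4)) * N := by
    have h1 : P ^ 4 / 4096 ≤ n * τ ^ 2 / 16 := by
      have : P ^ 8 * τ ^ 2 ≤ n * τ ^ 2 := by gcongr
      have h2 : P ^ 8 * τ ^ 2 = P ^ 4 / 256 := by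
        rw [hτ]
        field_simp
        norm_num
      linarith
    have h2 : Real.exp (-(n * τ ^ 2 / 16)) ≤
        Real.exp (-(1 / 8192 * P ^ 4)) * Real.exp (-(1 / 8192 * P ^ 4)) := by
      rw [← Real.exp_add]
      exact Real.exp_le_exp.2 (by linarith)
    have h3 : 2 * (t : ℝ) * d ≤ d ^ 3 := by nlinarith
    rw [← mul_assoc]
    refine mul_le_mul_of_nonneg_right ?_ (Nat.cast_nonneg _)
    calc 2 * t * d * Real.exp (-(n * τ ^ 2 / 16))
        ≤ d ^ 3 * (Real.exp (-(1 / 8192 * P ^ 4)) * Real.exp (-(1 / 8192 * P ^ 4))) := by gcongr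
      _ = (d ^ 3 * Real.exp (-(1 / 8192 * P ^ 4))) * Real.exp (-(1 / 8192 * P ^ 4)) := by ring
      _ ≤ 1 * Real.exp (-(1 / 8192 * P ^ 4)) := by gcongr
      _ = _ := one_mul _
  have hgood := Finset.card_filter_add_card_filter_not (s := Finset.univ)
    fun x : Fin n → Fin d → Bool => ∃ m j,
      n * τ ≤ |∑ i, (sampleGap (a m) (b m) j (x i) - meanGap (a m) (b m) j)|
  rw [Finset.card_univ] at hgood
  have hgood' := congrArg (Nat.cast : ℕ → ℝ) hgood
  rw [Nat.cast_add, ← hN] at hgood'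
  rw [Nat.card_eq_fintype_card, Fintype.card_subtype]
  refine le_trans ?_ (Nat.cast_le.2 (Finset.card_le_card
    (s := Finset.univ.filter fun x : Fin n → Fin d → Bool => ¬ ∃ m j,
      n * τ ≤ |∑ i, (sampleGap (a m) (b m) j (x i) - meanGap (a m) (b m) j)|)
    fun x hx => Finset.mem_filter.2 ⟨Finset.mem_univ x, ?_⟩))
  · linarith
  intro j
  replace hx := (Finset.mem_filter.1 hx).2
  push Not at hx
  have hgap : ∀ m j', |(1 / (n : ℝ)) * ∑ i, sampleGap (a m) (b m) j' (x i) -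
      meanGap (a m) (b m) j'| ≤ τ := fun m j' => by
    have h := (hx m j').le
    rw [Finset.sum_sub_distrib, Finset.sum_const, Finset.card_univ, Fintype.card_fin,
      nsmul_eq_mul] at h
    have h2 : (1 / (n : ℝ)) * ∑ i, sampleGap (a m) (b m) j' (x i) - meanGap (a m) (b m) j' =
        (∑ i, sampleGap (a m) (b m) j' (x i) - n * meanGap (a m) (b m) j') / n := by
      field_simp
    rw [h2, abs_div, abs_of_pos hnpos, div_le_iff₀ hnpos]
    linarith
  have hPinv : P⁻¹ ≤ 1 := inv_le_one_of_one_le₀ hP1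
  refine (abs_two_mul_sum_colSoftmax_sub_le htd _ jb hjb (δ := P⁻¹ / 8) (M := P / 32)
    (by positivity) (by linarith) (fun m => ?_) (fun m j' hja hjb' => ?_) j).trans ?_
  · rw [oneStepGD_sub_oneStepGD hdpos]
    have h : |(1 / (n : ℝ)) * ∑ i, sampleGap (a m) (b m) (b m) (x i)| ≤ τ := by
      simpa [meanGap] using hgap m (b m)
    refine (abs_mul _ _).trans_le ?_
    rw [abs_of_nonneg ((by positivity : 0 ≤ P / 2).trans hηd₁)]
    calc _ ≤ 2 * P * τ := mul_le_mul hηd₂ h (abs_nonneg _) (by positivity)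
      _ = P⁻¹ / 8 := by
        rw [hτ]
        field_simp
        norm_num
  · rw [oneStepGD_sub_oneStepGD hdpos]
    have h := (abs_le.1 (hgap m j')).1
    rw [meanGap, if_neg (not_or.2 ⟨hja, hjb'⟩)] at h
    have h' : 1 / 16 ≤ (1 / (n : ℝ)) * ∑ i, sampleGap (a m) (b m) j' (x i) := by linarith
    calc P / 32 = P / 2 * (1 / 16) := by ring
      _ ≤ _ := mul_le_mul hηd₁ h' (by norm_num) ((by positivity : 0 ≤ P / 2).trans hηd₁)
  · have h1 : 2 * (d * Real.exp (-(P / 32))) ≤ P⁻¹ := by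
      have hexp : Real.exp (-(P / 32)) = Real.exp (-(1 / 32 * P)) := by
        congr 1
        ring
      rw [hexp, ← one_div, le_div_iff₀ hP0]
      refine le_trans ?_ herr
      calc 2 * (d * Real.exp (-(1 / 32 * P))) * P = 2 * d * P * Real.exp (-(1 / 32 * P)) := by ring
        _ ≤ d ^ 2 * P * Real.exp (-(1 / 32 * P)) := by
          gcongr
          nlinarith
    linarith [inv_pos.2 hP0]
end

section
/- Let p ∈ (0, 0.1), let n, d ≥ 1 be integers, and set κ := 4·√(log(d/p)/n). Let the bits (xⁱ)_j for i ∈ [n], j ∈ [d] be i.i.d. uniform on {−1, +1}, and write x_j ∈ ℝⁿ for the vector ((x¹)_j, …, (xⁿ)_j). Then with probability at least 1 − p, simultaneously for every r ∈ {1,2,3,4} and every tuple (j₁, …, j_r) ∈ [d]^r such that the monomial x_{j₁}⋯x_{j_r} is not identically 1 (i.e., some index appears an odd number of times in the tuple), one has (1/n)·|Σ_{i=1}^n ∏_{l=1}^r (xⁱ)_{j_l}| ≤ κ. -/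
/-- A bounded observable that is odd under a bijection has sub-Gaussian exponential sums. -/
theorem sum_exp_mul_le_of_odd {α : Type*} [Fintype α] (f : α → ℝ) (σ : α ≃ α)
    (hσ : ∀ y, f (σ y) = -f y) (hf : ∀ y, f y ^ 2 ≤ 1) (t : ℝ) :
    ∑ y, Real.exp (t * f y) ≤ Fintype.card α * Real.exp (t ^ 2 / 2) := by
  have hflip : ∑ y, Real.exp (t * f y) = ∑ y, Real.exp (-(t * f y)) := by
    rw [← Equiv.sum_comp σ]
    simp only [hσ, mul_neg]
  have hcosh : ∑ y, Real.exp (t * f y) = ∑ y, Real.cosh (t * f y) := by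
    simp only [Real.cosh_eq, ← Finset.sum_div, Finset.sum_add_distrib]
    rw [← hflip]
    ring
  rw [hcosh, ← nsmul_eq_mul]
  refine Finset.sum_le_card_nsmul _ _ _ fun y _ => ?_
  refine (Real.cosh_le_exp_half_sq _).trans (Real.exp_le_exp.2 ?_)
  rw [mul_pow]
  nlinarith [hf y, sq_nonneg t]

/-- Hoeffding's inequality, in counting form, for an observable that is odd under a bijection. -/
theorem card_lt_abs_sum_le_of_odd {α : Type*} [Fintype α] (n : ℕ) (f : α → ℝ) (σ : α ≃ α)
    (hσ : ∀ y, f (σ y) = -f y) (hf : ∀ y, f y ^ 2 ≤ 1) {t : ℝ} (ht : 0 ≤ t) :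
    ((Finset.univ.filter fun x : Fin n → α => n * t < |∑ i, f (x i)|).card : ℝ) ≤
      2 * Fintype.card (Fin n → α) * Real.exp (-(n * t ^ 2 / 2)) := by
  classical
  have hmgf : ∀ s : ℝ, ∑ x : Fin n → α, Real.exp (s * ∑ i, f (x i)) ≤
      Fintype.card (Fin n → α) * Real.exp (n * s ^ 2 / 2) := by
    intro s
    calc ∑ x : Fin n → α, Real.exp (s * ∑ i, f (x i))
        = ∑ x : Fin n → α, ∏ i, Real.exp (s * f (x i)) := by
          simp only [Finset.mul_sum, Real.exp_sum]
      _ = (∑ y, Real.exp (s * f y)) ^ n := by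
          simpa using (Finset.prod_univ_sum (fun _ : Fin n => Finset.univ)
            fun _ y => Real.exp (s * f y)).symm
      _ ≤ (Fintype.card α * Real.exp (s ^ 2 / 2)) ^ n :=
          pow_le_pow_left₀ (Finset.sum_nonneg fun _ _ => (Real.exp_pos _).le)
            (sum_exp_mul_le_of_odd f σ hσ hf s) n
      _ = Fintype.card (Fin n → α) * Real.exp (n * s ^ 2 / 2) := by
          rw [mul_pow, ← Real.exp_nat_mul, mul_div_assoc]
          simp
  set B := Finset.univ.filter fun x : Fin n → α => n * t < |∑ i, f (x i)| with hB
  have hmarkov : (B.card : ℝ) * Real.exp (n * t ^ 2) ≤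
      2 * Fintype.card (Fin n → α) * Real.exp (n * t ^ 2 / 2) := by
    calc (B.card : ℝ) * Real.exp (n * t ^ 2)
        = ∑ x ∈ B, Real.exp (n * t ^ 2) := by simp
      _ ≤ ∑ x ∈ B, (Real.exp (t * ∑ i, f (x i)) + Real.exp (-t * ∑ i, f (x i))) := by
          refine Finset.sum_le_sum fun x hx => ?_
          have hx' : n * t < |∑ i, f (x i)| := by simpa [hB] using hx
          rcases lt_abs.1 hx' with h | h
          · refine le_add_of_le_of_nonneg (Real.exp_le_exp.2 ?_) (Real.exp_pos _).le
            nlinarith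
          · refine le_add_of_nonneg_of_le (Real.exp_pos _).le (Real.exp_le_exp.2 ?_)
            nlinarith
      _ ≤ ∑ x : Fin n → α, (Real.exp (t * ∑ i, f (x i)) + Real.exp (-t * ∑ i, f (x i))) :=
          Finset.sum_le_univ_sum_of_nonneg fun _ => by positivity
      _ ≤ 2 * Fintype.card (Fin n → α) * Real.exp (n * t ^ 2 / 2) := by
          rw [Finset.sum_add_distrib]
          have h₁ := hmgf t
          have h₂ := hmgf (-t)
          rw [neg_sq] at h₂
          linarith
  refine le_of_mul_le_mul_right (hmarkov.trans_eq ?_) (Real.exp_pos (n * t ^ 2))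
  rw [mul_assoc _ (Real.exp _), ← Real.exp_add]
  congr 2
  ring

/-- Negation of the bit at position `a`. -/
def flipBit {ι : Type*} [DecidableEq ι] (a : ι) : Equiv.Perm (ι → Bool) :=
  Function.Involutive.toPerm (fun y => Function.update y a (!y a)) fun y => by simp

theorem flipBit_apply {ι : Type*} [DecidableEq ι] (a : ι) (y : ι → Bool) :
    flipBit a y = Function.update y a (!y a) := rfl

/-- The monomial of the signs of the bits at the positions listed by `j`. -/
def signMonomial {ι κ : Type*} [Fintype κ] (j : κ → ι) (y : ι → Bool) : ℝ :=
  ∏ l, if y (j l) then (1 : ℝ) else -1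

theorem signMonomial_sq {ι κ : Type*} [Fintype κ] (j : κ → ι) (y : ι → Bool) :
    signMonomial j y ^ 2 = 1 := by
  rw [signMonomial, ← Finset.prod_pow]
  exact Finset.prod_eq_one fun l _ => by split_ifs <;> norm_num

theorem signMonomial_flipBit {ι κ : Type*} [DecidableEq ι] [Fintype κ] (j : κ → ι) {a : ι}
    (ha : Odd (Finset.univ.filter fun l => j l = a).card) (y : ι → Bool) :
    signMonomial j (flipBit a y) = -signMonomial j y := by
  have hfactor : ∀ l, (if flipBit a y (j l) then (1 : ℝ) else -1) =
      (if j l = a then -1 else 1) * if y (j l) then (1 : ℝ) else -1 := by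
    intro l
    by_cases h : j l = a
    · subst h
      cases hy : y (j l) <;> simp [flipBit_apply, hy]
    · simp [flipBit_apply, h]
  simp only [signMonomial, hfactor, Finset.prod_mul_distrib]
  rw [Finset.prod_ite, Finset.prod_const, ha.neg_one_pow]
  simp


/-- concentration of ±1 interaction terms: with bits i.i.d.
uniform on {±1} (encoded by Bool, with `true ↦ 1`, `false ↦ −1`), with
probability at least 1 − p, for every r ∈ {1,2,3,4} and every tuple
(j₁,…,j_r) ∈ [d]^r whose monomial is not identically 1 (some index occurs an
odd number of times), (1/n)·|⟨x_{j₁},…,x_{j_r}⟩| ≤ κ := 4√(log(d/p)/n).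
Probability over the uniform finite sample space is expressed by counting. -/
theorem stmt_3 (p : ℝ) (hp₁ : 0 < p) (hp₂ : p < 0.1) (n d : ℕ)
    (hn : 1 ≤ n) (hd : 1 ≤ d) :
    (1 - p) * (Fintype.card (Fin n → Fin d → Bool) : ℝ) ≤
      (Nat.card {x : Fin n → Fin d → Bool //
        ∀ (r : ℕ), 1 ≤ r → r ≤ 4 → ∀ j : Fin r → Fin d,
          (∃ a : Fin d, Odd (Finset.univ.filter (fun l => j l = a)).card) →
          ((1 : ℝ) / n) * |∑ i : Fin n, ∏ l : Fin r,
              (if x i (j l) then (1 : ℝ) else -1)| ≤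
            4 * Real.sqrt (Real.log ((d : ℝ) / p) / n)} : ℝ) := by
  classical
  have hn' : (0 : ℝ) < n := by exact_mod_cast hn
  have hd' : (1 : ℝ) ≤ d := by exact_mod_cast hd
  have hp₃ : p < 1 / 10 := by
    norm_num at hp₂ ⊢
    exact hp₂
  have hdp : 1 ≤ (d : ℝ) / p := by
    rw [le_div_iff₀ hp₁]
    linarith
  set κ : ℝ := 4 * Real.sqrt (Real.log ((d : ℝ) / p) / n) with hκ
  have hκ₀ : 0 ≤ κ := by positivity
  have hκ₂ : n * κ ^ 2 / 2 = 8 * Real.log (d / p) := by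
    rw [hκ, mul_pow, Real.sq_sqrt (div_nonneg (Real.log_nonneg hdp) hn'.le)]
    field_simp
    ring
  have hexp : Real.exp (-(n * κ ^ 2 / 2)) = (p / d) ^ 8 := by
    rw [hκ₂, ← mul_neg, ← Real.log_inv, inv_div, mul_comm, ← Real.rpow_def_of_pos (by positivity)]
    exact_mod_cast Real.rpow_natCast (p / d) 8
  set N : ℝ := (Fintype.card (Fin n → Fin d → Bool) : ℝ)
  have hN₀ : 0 ≤ N := by positivity
  let bad : (Σ r : Fin 4, Fin (r + 1) → Fin d) → Finset (Fin n → Fin d → Bool) := fun q =>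
    if ∃ a : Fin d, Odd (Finset.univ.filter (fun l => q.2 l = a)).card then
      Finset.univ.filter fun x => n * κ < |∑ i, signMonomial q.2 (x i)|
    else ∅
  have hbad : ∀ q, ((bad q).card : ℝ) ≤ 2 * N * (p / d) ^ 8 := by
    intro q
    by_cases h : ∃ a : Fin d, Odd (Finset.univ.filter (fun l => q.2 l = a)).card
    · simp only [bad, if_pos h]
      obtain ⟨a, ha⟩ := h
      rw [← hexp]
      exact card_lt_abs_sum_le_of_odd n _ (flipBit a) (signMonomial_flipBit q.2 ha)
        (fun y => (signMonomial_sq q.2 y).le) hκ₀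
    · simp only [bad, if_neg h, Finset.card_empty, Nat.cast_zero]
      positivity
  have hcount : ((Fintype.card (Σ r : Fin 4, Fin (r + 1) → Fin d) : ℕ) : ℝ) ≤ 4 * (d : ℝ) ^ 4 := by
    rw [Fintype.card_sigma]
    simp only [Fintype.card_fun, Fintype.card_fin]
    push_cast
    refine (Finset.sum_le_card_nsmul _ _ ((d : ℝ) ^ 4) fun r _ =>
      pow_le_pow_right₀ hd' (by omega)).trans_eq (by simp)
  have hunion : ((Finset.univ.biUnion bad).card : ℝ) ≤ p * N := by
    calc ((Finset.univ.biUnion bad).card : ℝ)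
        ≤ ∑ q, ((bad q).card : ℝ) := by exact_mod_cast Finset.card_biUnion_le
      _ ≤ Fintype.card (Σ r : Fin 4, Fin (r + 1) → Fin d) * (2 * N * (p / d) ^ 8) := by
          refine (Finset.sum_le_card_nsmul _ _ _ fun q _ => hbad q).trans_eq ?_
          simp
      _ ≤ 4 * (d : ℝ) ^ 4 * (2 * N * (p / d) ^ 8) := by gcongr
      _ = 8 * p ^ 7 * (1 / (d : ℝ) ^ 4) * (p * N) := by
          field_simp
          ring
      _ ≤ 8 * (1 / 10) ^ 7 * 1 * (p * N) := by
          gcongr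
          exact div_le_one_of_le₀ (one_le_pow₀ hd') (by positivity)
      _ ≤ p * N := by nlinarith [mul_nonneg hp₁.le hN₀]
  have hgood : (Finset.univ.biUnion bad)ᶜ ⊆ Finset.univ.filter fun x : Fin n → Fin d → Bool =>
      ∀ (r : ℕ), 1 ≤ r → r ≤ 4 → ∀ j : Fin r → Fin d,
        (∃ a : Fin d, Odd (Finset.univ.filter (fun l => j l = a)).card) →
        ((1 : ℝ) / n) * |∑ i : Fin n, ∏ l : Fin r,
          (if x i (j l) then (1 : ℝ) else -1)| ≤ κ := by
    intro x hx
    simp only [Finset.mem_compl, Finset.mem_biUnion, Finset.mem_univ, true_and, not_exists] at hx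
    simp only [Finset.mem_filter, Finset.mem_univ, true_and]
    intro r hr₁ hr₄ j hj
    obtain ⟨r, rfl⟩ : ∃ s, r = s + 1 := ⟨r - 1, by omega⟩
    have hxj := hx ⟨⟨r, by omega⟩, j⟩
    simp only [bad, if_pos hj, Finset.mem_filter, Finset.mem_univ, true_and, not_lt] at hxj
    rw [one_div, inv_mul_le_iff₀ hn']
    exact hxj
  rw [Nat.card_eq_fintype_card, Fintype.card_subtype]
  have hle : (((Finset.univ.biUnion bad)ᶜ).card : ℝ) ≤ _ :=
    Nat.cast_le.2 (Finset.card_le_card hgood)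
  refine le_trans ?_ hle
  rw [Finset.card_compl, Nat.cast_sub (Finset.card_le_univ _)]
  linarith
end

section
/- Let d ≥ 3, let w ∈ ℝ^d, let c₁ ≠ c₂ be indices in [d], let δ ∈ (0, 0.1), and let Δ > 0. Suppose that exp(|w_{c₁} − w_{c₂}|) ≤ 1 + δ, that w_j ≤ min(w_{c₁}, w_{c₂}) − Δ for every j ∉ {c₁, c₂}, and that (d − 2)·exp(−Δ) ≤ δ. Then, with σ_j(w) = exp(w_j)/Σ_{i=1}^d exp(w_i): (i) σ_j(w) ≤ exp(−Δ) for every j ∉ {c₁, c₂}; and (ii) both σ_{c₁}(w) and σ_{c₂}(w) lie in the interval [1/2 − 2δ, 1/2 + 2δ]. -/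
/-- Column softmax on ℝ^d : σ_j(w) = exp(w_j) / Σ_i exp(w_i). -/
noncomputable def softmax {d : ℕ} (w : Fin d → ℝ) : Fin d → ℝ :=
  fun α => Real.exp (w α) / ∑ i, Real.exp (w i)

theorem exp_le_mul_exp_of_exp_abs_sub_le {x y c : ℝ} (h : Real.exp |x - y| ≤ c) :
    Real.exp x ≤ c * Real.exp y := by
  calc Real.exp x = Real.exp (x - y) * Real.exp y := by rw [← Real.exp_add]; ring_nf
    _ ≤ c * Real.exp y := by
      gcongr
      exact (Real.exp_le_exp.2 (le_abs_self _)).trans h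

/-- A share `a / (a + b + r)` is close to one half when `a` and `b` are nearly equal and the
remainder `r` is small. -/
theorem div_add_add_near_half {a b r δ : ℝ} (ha : 0 < a) (hb : 0 < b) (hr : 0 ≤ r) (hδ : 0 < δ)
    (hab : a ≤ (1 + δ) * b) (hba : b ≤ (1 + δ) * a) (hra : r ≤ δ * a) :
    1 / 2 - 2 * δ ≤ a / (a + b + r) ∧ a / (a + b + r) ≤ 1 / 2 + 2 * δ := by
  have hδa := mul_pos hδ ha
  have hδb := mul_pos hδ hb
  have hδr := mul_nonneg hδ.le hr
  constructor
  · rw [le_div_iff₀ (by positivity)]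
    linarith
  · rw [div_le_iff₀ (by positivity)]
    linarith

theorem sum_eq_add_add_sum_erase_erase {ι : Type*} [Fintype ι] [DecidableEq ι] (f : ι → ℝ)
    {a b : ι} (hab : a ≠ b) :
    ∑ i, f i = f a + f b + ∑ i ∈ (Finset.univ.erase a).erase b, f i := by
  rw [← Finset.add_sum_erase _ f (Finset.mem_univ a),
    ← Finset.add_sum_erase _ f (Finset.mem_erase.2 ⟨hab.symm, Finset.mem_univ b⟩), add_assoc]

/-- softmax scores of a column with two dominant, nearly equal
entries c₁, c₂ separated by a gap Δ from all other entries. -/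
theorem stmt_11 (d : ℕ) (hd : 3 ≤ d) (w : Fin d → ℝ) (c₁ c₂ : Fin d) (hne : c₁ ≠ c₂)
    (δ Δ : ℝ) (hδ₁ : 0 < δ) (hδ₂ : δ < 0.1) (hΔ : 0 < Δ)
    (h₁ : Real.exp |w c₁ - w c₂| ≤ 1 + δ)
    (h₂ : ∀ j, j ≠ c₁ → j ≠ c₂ → w j ≤ min (w c₁) (w c₂) - Δ)
    (h₃ : ((d : ℝ) - 2) * Real.exp (-Δ) ≤ δ) :
    (∀ j, j ≠ c₁ → j ≠ c₂ → softmax w j ≤ Real.exp (-Δ)) ∧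
    (1 / 2 - 2 * δ ≤ softmax w c₁ ∧ softmax w c₁ ≤ 1 / 2 + 2 * δ) ∧
    (1 / 2 - 2 * δ ≤ softmax w c₂ ∧ softmax w c₂ ≤ 1 / 2 + 2 * δ) := by
  have hgap : ∀ j, j ≠ c₁ → j ≠ c₂ →
      Real.exp (w j) ≤ Real.exp (-Δ) * Real.exp (min (w c₁) (w c₂)) := by
    intro j hj₁ hj₂
    rw [← Real.exp_add]
    exact Real.exp_le_exp.2 (by linarith [h₂ j hj₁ hj₂])
  have hmin₁ : Real.exp (min (w c₁) (w c₂)) ≤ Real.exp (w c₁) :=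
    Real.exp_le_exp.2 (min_le_left _ _)
  have hmin₂ : Real.exp (min (w c₁) (w c₂)) ≤ Real.exp (w c₂) :=
    Real.exp_le_exp.2 (min_le_right _ _)
  have hsum := sum_eq_add_add_sum_erase_erase (fun i => Real.exp (w i)) hne
  set R := ∑ i ∈ (Finset.univ.erase c₁).erase c₂, Real.exp (w i)
  have hR₀ : 0 ≤ R := Finset.sum_nonneg fun i _ => (Real.exp_pos _).le
  have hcard : (((Finset.univ.erase c₁).erase c₂).card : ℝ) = (d : ℝ) - 2 := by
    rw [Finset.card_erase_of_mem (Finset.mem_erase.2 ⟨hne.symm, Finset.mem_univ _⟩),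
      Finset.card_erase_of_mem (Finset.mem_univ _), Finset.card_univ, Fintype.card_fin,
      Nat.sub_sub, Nat.cast_sub (by omega)]
    norm_num
  have hR : R ≤ δ * Real.exp (min (w c₁) (w c₂)) := by
    calc R ≤ ((Finset.univ.erase c₁).erase c₂).card •
          (Real.exp (-Δ) * Real.exp (min (w c₁) (w c₂))) :=
        Finset.sum_le_card_nsmul _ _ _ fun i hi => by
          simp only [Finset.mem_erase] at hi
          exact hgap i hi.2.1 hi.1
      _ = ((d : ℝ) - 2) * Real.exp (-Δ) * Real.exp (min (w c₁) (w c₂)) := by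
        rw [nsmul_eq_mul, hcard, mul_assoc]
      _ ≤ δ * Real.exp (min (w c₁) (w c₂)) := by gcongr
  have hR₁ : R ≤ δ * Real.exp (w c₁) := hR.trans (by gcongr)
  have hR₂ : R ≤ δ * Real.exp (w c₂) := hR.trans (by gcongr)
  have hA := Real.exp_pos (w c₁)
  have hB := Real.exp_pos (w c₂)
  have h₁₂ := exp_le_mul_exp_of_exp_abs_sub_le h₁
  have h₂₁ := exp_le_mul_exp_of_exp_abs_sub_le (abs_sub_comm (w c₁) (w c₂) ▸ h₁)
  simp only [softmax, hsum]
  refine ⟨fun j hj₁ hj₂ => ?_, div_add_add_near_half hA hB hR₀ hδ₁ h₁₂ h₂₁ hR₁, ?_⟩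
  · rw [div_le_iff₀ (by positivity)]
    refine (hgap j hj₁ hj₂).trans ?_
    gcongr
    linarith
  · rw [add_comm (Real.exp (w c₁))]
    exact div_add_add_near_half hB hA hR₀ hδ₁ h₂₁ h₁₂ hR₂
end
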